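/- Let F be a field with char F ≠ 2, D a quaternion algebra over F, and V_D the F-space of 2×2 Hermitian matrices X = [[a·1, x], [x̄, d·1]] (a, d ∈ F, x ∈ D) inside M₂(D). For g ∈ GL₂(D) and z ∈ F×, the map X ↦ z·g·X·g* (where g* is the conjugate-transpose of g, with entrywise conjugation x ↦ x̄) sends V_D into V_D, and (g, z)·X := z·g·X·g* defines an action of the group GL₂(D) × F× on V_D by F-linear automorphisms whose kernel is exactly {(z·1₂, z⁻²) : z ∈ F×}. -/

import Mathlib

open Quaternion Matrix

/-- The algebra `M₂(D)` of `2×2` matrices over `D = ℍ[F,c₁,c₂]`. -/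
abbrev M2D (F : Type*) [Field F] (c₁ c₂ : F) := Matrix (Fin 2) (Fin 2) ℍ[F, c₁, c₂]

/-- The space `V_D` of `2×2` Hermitian matrices over `D = ℍ[F,c₁,c₂]`: matrices
`[[a·1, x], [x̄, d·1]]` with `a, d ∈ F`, `x ∈ D`, as an `F`-submodule of `M₂(D)`. -/
def hermitianSub (F : Type*) [Field F] (c₁ c₂ : F) : Submodule F (M2D F c₁ c₂) where
  carrier := {X | (∃ a : F, X 0 0 = algebraMap F ℍ[F, c₁, c₂] a) ∧
    (∃ d : F, X 1 1 = algebraMap F ℍ[F, c₁, c₂] d) ∧ X 1 0 = star (X 0 1)}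
  add_mem' := by
    rintro X Y ⟨⟨a, ha⟩, ⟨d, hd⟩, hx⟩ ⟨⟨a', ha'⟩, ⟨d', hd'⟩, hx'⟩
    refine ⟨⟨a + a', ?_⟩, ⟨d + d', ?_⟩, ?_⟩ <;>
      simp [Matrix.add_apply, ha, ha', hd, hd', hx, hx', map_add, star_add]
  zero_mem' := ⟨⟨0, by simp⟩, ⟨0, by simp⟩, by simp⟩
  smul_mem' := by
    rintro c X ⟨⟨a, ha⟩, ⟨d, hd⟩, hx⟩
    refine ⟨⟨c * a, ?_⟩, ⟨c * d, ?_⟩, ?_⟩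
    · rw [Matrix.smul_apply, ha, Algebra.smul_def, ← _root_.map_mul]
    · rw [Matrix.smul_apply, hd, Algebra.smul_def, ← _root_.map_mul]
    · rw [Matrix.smul_apply, Matrix.smul_apply, hx, QuaternionAlgebra.star_smul]

namespace QuaternionAlgebra

variable {F : Type*} [Field F] {c₁ c₂ : F}

theorem star_eq_self_iff_exists_algebraMap (hF : (2 : F) ≠ 0) {a : ℍ[F, c₁, c₂]} :
    star a = a ↔ ∃ r : F, a = algebraMap F ℍ[F, c₁, c₂] r := by
  constructor
  · intro h
    have key : ∀ x : F, -x = x → x = 0 := fun x hx => by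
      have : (2 : F) * x = 0 := by linear_combination -hx
      exact (mul_eq_zero.mp this).resolve_left hF
    exact ⟨a.re, QuaternionAlgebra.ext rfl (key _ (congrArg imI h)) (key _ (congrArg imJ h))
      (key _ (congrArg imK h))⟩
  · rintro ⟨r, rfl⟩
    exact star_coe r

theorem exists_eq_algebraMap_of_forall_commute (hF : (2 : F) ≠ 0) (hc₁ : c₁ ≠ 0)
    {a : ℍ[F, c₁, c₂]} (h : ∀ x, Commute a x) : ∃ r : F, a = algebraMap F ℍ[F, c₁, c₂] r := by
  have hi := (h ⟨0, 1, 0, 0⟩).eq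
  have hj := (h ⟨0, 0, 1, 0⟩).eq
  have hγ : 2 * a.imJ = 0 := by
    have := congrArg imK hi
    simp at this
    linear_combination -this
  have hδ : 2 * (c₁ * a.imK) = 0 := by
    have := congrArg imJ hi
    simp at this
    linear_combination -this
  have hβ : 2 * a.imI = 0 := by
    have := congrArg imK hj
    simp at this
    linear_combination this
  exact ⟨a.re, QuaternionAlgebra.ext rfl ((mul_eq_zero.mp hβ).resolve_left hF)
    ((mul_eq_zero.mp hγ).resolve_left hF)
    ((mul_eq_zero.mp ((mul_eq_zero.mp hδ).resolve_left hF)).resolve_left hc₁)⟩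

theorem conjTranspose_smul {m n : Type*} (z : F) (A : Matrix m n ℍ[F, c₁, c₂]) :
    (z • A)ᴴ = z • Aᴴ := by
  ext1 i j
  exact star_smul' z (A j i)

theorem conjTranspose_algebraMap (t : F) :
    (algebraMap F (M2D F c₁ c₂) t)ᴴ = algebraMap F (M2D F c₁ c₂) t := by
  rw [Algebra.algebraMap_eq_smul_one, conjTranspose_smul, conjTranspose_one]

end QuaternionAlgebra

section HermitianSub

variable {F : Type*} [Field F] {c₁ c₂ : F}

theorem mem_hermitianSub_iff (hF : (2 : F) ≠ 0) {X : M2D F c₁ c₂} :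
    X ∈ hermitianSub F c₁ c₂ ↔ X.IsHermitian := by
  change ((∃ a : F, _) ∧ (∃ d : F, _) ∧ _) ↔ _
  rw [← QuaternionAlgebra.star_eq_self_iff_exists_algebraMap hF,
    ← QuaternionAlgebra.star_eq_self_iff_exists_algebraMap hF, Matrix.IsHermitian.ext_iff]
  simp only [Fin.forall_fin_two]
  constructor
  · rintro ⟨h0, h1, h⟩
    exact ⟨⟨h0, by rw [h, star_star]⟩, h.symm, h1⟩
  · rintro ⟨⟨h0, -⟩, h, h1⟩
    exact ⟨h0, h1, h.symm⟩

theorem smul_mul_mul_conjTranspose_mem_hermitianSub (hF : (2 : F) ≠ 0) (g : M2D F c₁ c₂) (z : F)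
    {X : M2D F c₁ c₂} (hX : X ∈ hermitianSub F c₁ c₂) :
    z • (g * X * gᴴ) ∈ hermitianSub F c₁ c₂ :=
  Submodule.smul_mem _ z <| (mem_hermitianSub_iff hF).2 <|
    isHermitian_mul_mul_conjTranspose g ((mem_hermitianSub_iff hF).1 hX)

/-- The monoid homomorphism sending `(g, z)` to the endomorphism `X ↦ z • (g * X * gᴴ)` of the
space of Hermitian matrices. -/
def hermitianSubEnd (hF : (2 : F) ≠ 0) :
    (M2D F c₁ c₂)ˣ × Fˣ →* Module.End F (hermitianSub F c₁ c₂) where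
  toFun p :=
    { toFun X := ⟨p.2.val • (p.1.val * X * (p.1.val)ᴴ),
        smul_mul_mul_conjTranspose_mem_hermitianSub hF _ _ X.2⟩
      map_add' X Y := Subtype.ext <| by simp [mul_add, add_mul]
      map_smul' r X := Subtype.ext <| by simp [smul_comm r] }
  map_one' := by
    ext1 X
    exact Subtype.ext <| by simp
  map_mul' p q := by
    ext1 X
    exact Subtype.ext <| by simp [mul_assoc, mul_smul]

/-- A matrix over `ℍ[F,c₁,c₂]` commuting with all Hermitian matrices is a scalar. -/
theorem exists_eq_algebraMap_of_commute_hermitianSub (hF : (2 : F) ≠ 0) (hc₁ : c₁ ≠ 0)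
    {g : M2D F c₁ c₂} (h : ∀ X ∈ hermitianSub F c₁ c₂, Commute g X) :
    ∃ t : F, g = algebraMap F (M2D F c₁ c₂) t := by
  have hdiag := (h !![1, 0; 0, 0] ⟨⟨1, by simp⟩, ⟨0, by simp⟩, by simp⟩).eq
  have hoff (x : ℍ[F, c₁, c₂]) :=
    (h !![0, x; star x, 0] ⟨⟨0, by simp⟩, ⟨0, by simp⟩, by simp⟩).eq
  have h01 : g 0 1 = 0 := by
    simpa [Matrix.mul_apply, Fin.sum_univ_two] using (congrFun₂ hdiag 0 1).symm
  have h10 : g 1 0 = 0 := by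
    simpa [Matrix.mul_apply, Fin.sum_univ_two] using congrFun₂ hdiag 1 0
  have hx (x : ℍ[F, c₁, c₂]) : g 0 0 * x = x * g 1 1 := by
    simpa [Matrix.mul_apply, Fin.sum_univ_two] using congrFun₂ (hoff x) 0 1
  have h11 : g 0 0 = g 1 1 := by simpa using hx 1
  obtain ⟨t, ht⟩ := QuaternionAlgebra.exists_eq_algebraMap_of_forall_commute hF hc₁
    (a := g 0 0) fun x => (hx x).trans (by rw [h11])
  refine ⟨t, ?_⟩
  ext1 i j
  fin_cases i <;> fin_cases j <;> simp [Matrix.algebraMap_matrix_apply, h01, h10, ← h11, ht]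

theorem forall_smul_mul_mul_conjTranspose_eq_iff (hF : (2 : F) ≠ 0) (hc₁ : c₁ ≠ 0)
    (g : (M2D F c₁ c₂)ˣ) (z : Fˣ) :
    (∀ X ∈ hermitianSub F c₁ c₂, z.val • (g.val * X * (g.val)ᴴ) = X) ↔
      ∃ t : Fˣ, g.val = algebraMap F (M2D F c₁ c₂) t ∧ z = t⁻¹ * t⁻¹ := by
  constructor
  · intro h
    have hone : g.val * (z.val • (g.val)ᴴ) = 1 := by
      simpa using h 1 ((mem_hermitianSub_iff hF).2 isHermitian_one)
    have hinv : (z.val • (g.val)ᴴ) * g.val = 1 := by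
      rw [← Units.inv_eq_of_mul_eq_one_right hone, Units.inv_mul]
    obtain ⟨t, ht⟩ := exists_eq_algebraMap_of_commute_hermitianSub hF hc₁ (g := g.val)
      fun X hX => by
        have hX' : g.val * X * (z.val • (g.val)ᴴ) = X := by
          rw [mul_smul_comm]
          exact h X hX
        calc g.val * X = g.val * X * ((z.val • (g.val)ᴴ) * g.val) := by rw [hinv, mul_one]
          _ = X * g.val := by rw [← mul_assoc, hX']
    have htz : t * (z * t) = 1 := by
      apply FaithfulSMul.algebraMap_injective F (M2D F c₁ c₂)
      rw [ht, QuaternionAlgebra.conjTranspose_algebraMap, Algebra.smul_def] at hone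
      simpa only [_root_.map_mul, _root_.map_one] using hone
    refine ⟨Units.mk0 t (left_ne_zero_of_mul_eq_one htz), ht, ?_⟩
    rw [← mul_inv, eq_inv_iff_mul_eq_one]
    ext
    simp only [Units.val_mul, Units.val_mk0, Units.val_one]
    linear_combination htz
  · rintro ⟨t, ht, rfl⟩ X -
    rw [ht, QuaternionAlgebra.conjTranspose_algebraMap, ← Algebra.smul_def,
      ← Algebra.commutes, ← Algebra.smul_def, smul_smul, smul_smul]
    simp

end HermitianSub

/-- for `g ∈ GL₂(D)`, `z ∈ F×`, the map `X ↦ z·g·X·g*` (with `g*` the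
conjugate-transpose) preserves the space `V_D` of Hermitian matrices, and
`(g, z)·X := z·g·X·g*` defines an action of `GL₂(D) × F×` on `V_D` by `F`-linear
automorphisms whose kernel is exactly `{(z·1₂, z⁻²) : z ∈ F×}`. -/
theorem GL2D_action_on_hermitian_matrices
    (F : Type*) [Field F] (hF : (2 : F) ≠ 0) (c₁ c₂ : F) (hc₁ : c₁ ≠ 0) (hc₂ : c₂ ≠ 0) :
    (∀ (g : (M2D F c₁ c₂)ˣ) (z : Fˣ) (X : M2D F c₁ c₂), X ∈ hermitianSub F c₁ c₂ →
      z.val • (g.val * X * (g.val)ᴴ) ∈ hermitianSub F c₁ c₂) ∧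
    ∃ Φ : ((M2D F c₁ c₂)ˣ × Fˣ) →*
        ((hermitianSub F c₁ c₂) ≃ₗ[F] (hermitianSub F c₁ c₂)),
      (∀ (p : (M2D F c₁ c₂)ˣ × Fˣ) (X : hermitianSub F c₁ c₂),
        ((Φ p) X : M2D F c₁ c₂)
          = p.2.val • (p.1.val * (X : M2D F c₁ c₂) * (p.1.val)ᴴ)) ∧
      (∀ p : (M2D F c₁ c₂)ˣ × Fˣ, p ∈ Φ.ker ↔
        ∃ t : Fˣ, p.1.val = algebraMap F (M2D F c₁ c₂) (t : F) ∧ p.2 = t⁻¹ * t⁻¹) := by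
  refine ⟨fun g z X hX => smul_mul_mul_conjTranspose_mem_hermitianSub hF _ _ hX,
    (LinearMap.GeneralLinearGroup.generalLinearEquiv F _).toMonoidHom.comp
      (hermitianSubEnd hF).toHomUnits, fun p X => rfl, fun p => ?_⟩
  rw [← forall_smul_mul_mul_conjTranspose_eq_iff hF hc₁, MonoidHom.mem_ker]
  constructor
  · intro h X hX
    exact congrArg Subtype.val (LinearEquiv.congr_fun h ⟨X, hX⟩)
  · intro h
    ext1 X
    exact Subtype.ext (h X X.2)
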